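/- For even d = 2N, every angle vector Θ = (θ_1, …, θ_N), all row vectors x, y ∈ ℝ^d, and all indices i, j ∈ ℤ: ⟨ x R^d_{Θ,i}, y R^d_{Θ,j} ⟩ = x · R^d_{Θ,i−j} · yᵀ; in particular the inner product of RoPE-embedded queries and keys depends on the token positions only through their difference i − j. -/

import Mathlib

open Matrix

/-- The 2×2 planar rotation matrix `[[cos θ, sin θ], [−sin θ, cos θ]]`. -/
noncomputable def rot (θ : ℝ) : Matrix (Fin 2) (Fin 2) ℝ :=
  !![Real.cos θ, Real.sin θ; -Real.sin θ, Real.cos θ]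

/-- The RoPE matrix `R^{2N}_{Θ,i}` for an integer index `i`: block-diagonal
with n-th 2×2 block the rotation by angle `i·θ_n`. -/
noncomputable def ropeM (N : ℕ) (Θ : Fin N → ℝ) (i : ℤ) :
    Matrix (Fin 2 × Fin N) (Fin 2 × Fin N) ℝ :=
  Matrix.blockDiagonal fun n => rot ((i : ℝ) * Θ n)

theorem rot_mul_transpose_rot (a b : ℝ) : rot a * (rot b)ᵀ = rot (a - b) := by
  ext k l
  fin_cases k <;> fin_cases l <;>
    simp [rot, Matrix.mul_apply, Fin.sum_univ_two, Real.cos_sub, Real.sin_sub] <;> ring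

theorem ropeM_mul_transpose_ropeM (N : ℕ) (Θ : Fin N → ℝ) (i j : ℤ) :
    ropeM N Θ i * (ropeM N Θ j)ᵀ = ropeM N Θ (i - j) := by
  simp only [ropeM, blockDiagonal_transpose, ← blockDiagonal_mul, rot_mul_transpose_rot,
    Int.cast_sub, sub_mul]

theorem stmt14 (N : ℕ) (Θ : Fin N → ℝ) (x y : Fin 2 × Fin N → ℝ) (i j : ℤ) :
    (x ᵥ* ropeM N Θ i) ⬝ᵥ (y ᵥ* ropeM N Θ j)
      = (x ᵥ* ropeM N Θ (i - j)) ⬝ᵥ y := by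
  rw [← mulVec_transpose (ropeM N Θ j), dotProduct_mulVec, vecMul_vecMul,
    ropeM_mul_transpose_ropeM]
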